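/- Let (X,d) be a strongly geodesic δ-hyperbolic G-space with δ > 0, let U ≤ G be a nontrivial subgroup, and suppose A ⊆ X is a nonempty, C-quasiconvex, U-invariant set such that A is contained in the closed C-neighborhood of X(U) and E(U) ⊆ A. Then X(U) and A are (3C + 4δ)-Hausdorff close. -/

import Mathlib

noncomputable section

namespace KW

open Metric Set Pointwise

variable {X : Type*} [MetricSpace X]

/-- `s` is (the image of) a unit-speed geodesic segment joining `x` to `y`. -/
def IsGeodesicSegment (s : Set X) (x y : X) : Prop :=
  ∃ (b : ℝ) (f : ℝ → X), 0 ≤ b ∧ f 0 = x ∧ f b = y ∧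
    (∀ u ∈ Set.Icc (0 : ℝ) b, ∀ v ∈ Set.Icc (0 : ℝ) b, dist (f u) (f v) = |u - v|) ∧
    s = f '' Set.Icc 0 b

/-- A geodesic metric space. -/
def GeodesicSpace (X : Type*) [MetricSpace X] : Prop :=
  ∀ x y : X, ∃ s : Set X, IsGeodesicSegment s x y

/-- `X` is `δ`-hyperbolic: geodesic, and every geodesic triangle is `δ`-thin. -/
def DeltaHyperbolic (δ : ℝ) (X : Type*) [MetricSpace X] : Prop :=
  GeodesicSpace X ∧
    ∀ (x y z : X) (s₁ s₂ s₃ : Set X),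
      IsGeodesicSegment s₁ x y → IsGeodesicSegment s₂ y z → IsGeodesicSegment s₃ x z →
      ∀ p ∈ s₁, ∃ q ∈ s₂ ∪ s₃, dist p q ≤ δ

/-- `A` is an `ε`-quasiconvex subset of `X`. -/
def Quasiconvex (ε : ℝ) (A : Set X) : Prop :=
  ∀ x ∈ A, ∀ y ∈ A, ∀ s : Set X, IsGeodesicSegment s x y → ∀ p ∈ s, ∃ a ∈ A, dist p a ≤ ε

/-- The Gromov product `(y,z)_x`. -/
def gromov (x y z : X) : ℝ := (dist y x + dist z x - dist y z) / 2

def IsGeodesicRay (γ : ℝ → X) : Prop :=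
  ∀ s t : ℝ, 0 ≤ s → 0 ≤ t → dist (γ s) (γ t) = |s - t|

def IsBiGeodesic (γ : ℝ → X) : Prop :=
  ∀ s t : ℝ, dist (γ s) (γ t) = |s - t|

/-- `A` and `B` are `K`-Hausdorff close. -/
def HClose (K : ℝ) (A B : Set X) : Prop :=
  (∀ a ∈ A, ∃ b ∈ B, dist a b ≤ K) ∧ ∀ b ∈ B, ∃ a ∈ A, dist a b ≤ K

def HausdorffClose (A B : Set X) : Prop := ∃ K : ℝ, HClose K A B

/-- Two geodesic rays are asymptotic iff their images are Hausdorff close. -/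
def Asymptotic (γ γ' : ℝ → X) : Prop :=
  HausdorffClose (γ '' Set.Ici 0) (γ' '' Set.Ici 0)

def GRay (X : Type*) [MetricSpace X] : Type _ := {γ : ℝ → X // IsGeodesicRay γ}

theorem asymptotic_refl (γ : ℝ → X) : Asymptotic γ γ :=
  ⟨0, fun a ha => ⟨a, ha, by simp⟩, fun b hb => ⟨b, hb, by simp⟩⟩

theorem asymptotic_symm {γ γ' : ℝ → X} (h : Asymptotic γ γ') : Asymptotic γ' γ := by
  obtain ⟨K, h₁, h₂⟩ := h
  refine ⟨K, fun a ha => ?_, fun b hb => ?_⟩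
  · obtain ⟨b, hb, hd⟩ := h₂ a ha
    exact ⟨b, hb, by rwa [dist_comm]⟩
  · obtain ⟨a, ha, hd⟩ := h₁ b hb
    exact ⟨a, ha, by rwa [dist_comm]⟩

theorem asymptotic_trans {γ₁ γ₂ γ₃ : ℝ → X} (h : Asymptotic γ₁ γ₂)
    (h' : Asymptotic γ₂ γ₃) : Asymptotic γ₁ γ₃ := by
  obtain ⟨K, h₁, h₂⟩ := h
  obtain ⟨K', h₁', h₂'⟩ := h'
  refine ⟨K + K', fun a ha => ?_, fun c hc => ?_⟩
  · obtain ⟨b, hb, hab⟩ := h₁ a ha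
    obtain ⟨c, hc, hbc⟩ := h₁' b hb
    exact ⟨c, hc, (dist_triangle a b c).trans (by linarith)⟩
  · obtain ⟨b, hb, hbc⟩ := h₂' c hc
    obtain ⟨a, ha, hab⟩ := h₂ b hb
    exact ⟨a, ha, (dist_triangle a b c).trans (by linarith)⟩

def raySetoid (X : Type*) [MetricSpace X] : Setoid (GRay X) where
  r γ γ' := Asymptotic γ.1 γ'.1
  iseqv := ⟨fun γ => asymptotic_refl γ.1, fun h => asymptotic_symm h,
    fun h h' => asymptotic_trans h h'⟩

/-- The (geodesic) boundary of `X`: asymptoty classes of geodesic rays. -/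
def Boundary (X : Type*) [MetricSpace X] : Type _ := Quotient (raySetoid X)

def Boundary.mk {X : Type*} [MetricSpace X] (γ : GRay X) : Boundary X :=
  Quotient.mk (raySetoid X) γ

/-- A strongly geodesic metric space. -/
def StronglyGeodesic (X : Type*) [MetricSpace X] : Prop :=
  GeodesicSpace X ∧
  (∀ γ : ℝ → X, IsGeodesicRay γ → ∀ y : X,
      ∃ γ' : ℝ → X, IsGeodesicRay γ' ∧ γ' 0 = y ∧ Asymptotic γ γ') ∧
  (∀ γ₁ γ₂ : ℝ → X, IsGeodesicRay γ₁ → IsGeodesicRay γ₂ → γ₁ 0 = γ₂ 0 →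
      ¬ Asymptotic γ₁ γ₂ →
      ∃ γ : ℝ → X, IsBiGeodesic γ ∧
        HausdorffClose (Set.range γ) (γ₁ '' Set.Ici 0 ∪ γ₂ '' Set.Ici 0)) ∧
  (∀ (x : X) (u : ℕ → X),
      (∀ M : ℝ, ∃ N : ℕ, ∀ n, N ≤ n → ∀ m, N ≤ m → M ≤ gromov x (u n) (u m)) →
      ∃ γ : ℝ → X, IsGeodesicRay γ ∧ γ 0 = x ∧
        ∀ M : ℝ, ∃ N : ℕ, ∀ n, N ≤ n → ∀ m, N ≤ m → M ≤ gromov x (γ (n : ℝ)) (u m))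

/-- The sequence `u` converges to the boundary point `p`, with basepoint `x`. -/
def SeqConvTo (x : X) (u : ℕ → X) (p : Boundary X) : Prop :=
  ∃ γ : GRay X, Boundary.mk γ = p ∧
    ∀ M : ℝ, ∃ N : ℕ, ∀ n, N ≤ n → ∀ m, N ≤ m → M ≤ gromov x (u n) (γ.1 (m : ℝ))

/-- `γ` is a geodesic ray in the class of the boundary point `p`. -/
def RayTo (γ : ℝ → X) (p : Boundary X) : Prop :=
  ∃ h : IsGeodesicRay γ, Boundary.mk ⟨γ, h⟩ = p

/-- `γ` is a biinfinite geodesic whose two ends converge to `p` and `q`. -/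
def BiGeodesicJoins (γ : ℝ → X) (p q : Boundary X) : Prop :=
  IsBiGeodesic γ ∧ SeqConvTo (γ 0) (fun n => γ (-(n : ℝ))) p ∧
    SeqConvTo (γ 0) (fun n => γ (n : ℝ)) q

/-- `s` is (the image of) a geodesic joining two points of `X ∪ ∂X`. -/
def JoinSet : X ⊕ Boundary X → X ⊕ Boundary X → Set X → Prop
  | Sum.inl x, Sum.inl y, s => IsGeodesicSegment s x y
  | Sum.inl x, Sum.inr p, s => ∃ γ : ℝ → X, γ 0 = x ∧ RayTo γ p ∧ s = γ '' Set.Ici 0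
  | Sum.inr p, Sum.inl x, s => ∃ γ : ℝ → X, γ 0 = x ∧ RayTo γ p ∧ s = γ '' Set.Ici 0
  | Sum.inr p, Sum.inr q, s => ∃ γ : ℝ → X, BiGeodesicJoins γ p q ∧ s = Set.range γ

/-- The convex hull `Conv(A)` of a subset `A ⊆ X ∪ ∂X`. -/
def geoConv (A : Set (X ⊕ Boundary X)) : Set X :=
  {x | (∃ a : X, A = {Sum.inl a} ∧ x = a) ∨
    ∃ p ∈ A, ∃ q ∈ A, p ≠ q ∧ ∃ s : Set X, JoinSet p q s ∧ x ∈ s}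

/-- The distance between two subsets of `X`. -/
def setDist (A B : Set X) : ℝ := sInf (Set.image2 dist A B)

/-- `a` is a projection of `p` on `A` (relative to `δ`). -/
def IsProjection (δ : ℝ) (A : Set X) (p a : X) : Prop :=
  a ∈ A ∧ ∀ a' ∈ A, dist p a ≤ dist p a' + δ

/-- `f` restricted to `[0,L]` is a unit-speed geodesic from `x` to `y`. -/
def GeodParam (f : ℝ → X) (L : ℝ) (x y : X) : Prop :=
  0 ≤ L ∧ f 0 = x ∧ f L = y ∧
    ∀ u ∈ Set.Icc (0 : ℝ) L, ∀ v ∈ Set.Icc (0 : ℝ) L, dist (f u) (f v) = |u - v|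

/-- Concatenation of three paths, the first on `[0,a]`, the second on `[0,b]`. -/
def concat3 (f₁ f₂ f₃ : ℝ → X) (a b : ℝ) : ℝ → X := fun t =>
  if t ≤ a then f₁ t else if t ≤ a + b then f₂ (t - a) else f₃ (t - a - b)

/-- `f` is a `(lam, ε)`-quasigeodesic on `[a,b]`. -/
def QuasigeodesicOn (lam ε : ℝ) (f : ℝ → X) (a b : ℝ) : Prop :=
  ∀ s ∈ Set.Icc a b, ∀ t ∈ Set.Icc a b, |s - t| ≤ lam * dist (f s) (f t) + ε

/-- The action of `G` on `X` is by isometries. -/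
def IsometricAction (G Y : Type*) [Group G] [MetricSpace Y] [MulAction G Y] : Prop :=
  ∀ (g : G) (x y : Y), dist (g • x) (g • y) = dist x y

section GroupAction

variable {G : Type*} [Group G]

/-- The limit set `Λ(U) ⊆ ∂X` of a subgroup `U ≤ G`. -/
def limitSet (X : Type*) [MetricSpace X] [MulAction G X] (U : Subgroup G) :
    Set (Boundary X) :=
  {p | ∃ x₀ : X, ∃ u : ℕ → U, SeqConvTo x₀ (fun n => ((u n : G)) • x₀) p}

/-- The small displacement set `E(U)` (relative to `δ`). -/
def smallDispSet (X : Type*) [MetricSpace X] [MulAction G X] (δ : ℝ) (U : Subgroup G) :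
    Set X :=
  {x | ∃ u : G, u ∈ U ∧ u ≠ 1 ∧ dist x (u • x) ≤ 100 * δ}

/-- `Z(U) = Conv(Λ(U) ∪ E(U))`. -/
def ZSet (X : Type*) [MetricSpace X] [MulAction G X] (δ : ℝ) (U : Subgroup G) : Set X :=
  geoConv (Sum.inr '' limitSet X U ∪ Sum.inl '' smallDispSet X δ U)

/-- The convex hull `X(U)`: the closure of `Conv(Z(U))`. -/
def cHull (X : Type*) [MetricSpace X] [MulAction G X] (δ : ℝ) (U : Subgroup G) : Set X :=
  closure (geoConv (Sum.inl '' ZSet X δ U))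

/-- The weak convex hull `X_U = Conv(Λ(U))`. -/
def weakHull (X : Type*) [MetricSpace X] [MulAction G X] (U : Subgroup G) : Set X :=
  geoConv (Sum.inr '' limitSet X U)

/-- `l_V(g) = d(X(V), gX(V))`. -/
def lV (X : Type*) [MetricSpace X] [MulAction G X] (δ : ℝ) (V : Subgroup G) (g : G) : ℝ :=
  setDist (cHull X δ V) (g • cHull X δ V)

/-- The translation length of `g`. -/
def translationLength (X : Type*) [MetricSpace X] [MulAction G X] (g : G) : ℝ :=
  sInf (Set.range fun x : X => dist x (g • x))

/-- The asymptotic translation length of `g`. -/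
def asympTranslationLength (X : Type*) [MetricSpace X] [MulAction G X] (g : G) : ℝ :=
  Filter.liminf (fun n : ℕ => translationLength X (g ^ n) / (n : ℝ)) Filter.atTop

/-- An elementary move between `G`-tuples `(U₁,…,U_n; h₁,…,h_m)`. -/
def gMove {n m : ℕ} (M M' : (Fin n → Subgroup G) × (Fin m → G)) : Prop :=
  (M'.2 = M.2 ∧ ∃ (j : Fin n) (g : G),
      g ∈ Subgroup.closure (Set.range M.2 ∪ ⋃ i ∈ {i : Fin n | i ≠ j}, ((M.1 i : Set G))) ∧
      (∀ i, i ≠ j → M'.1 i = M.1 i) ∧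
      M'.1 j = Subgroup.map (MulAut.conj g).toMonoidHom (M.1 j)) ∨
  (M'.1 = M.1 ∧ ∃ (i : Fin m) (g₁ g₂ : G),
      g₁ ∈ Subgroup.closure (M.2 '' {j : Fin m | j ≠ i} ∪ ⋃ t, ((M.1 t : Set G))) ∧
      g₂ ∈ Subgroup.closure (M.2 '' {j : Fin m | j ≠ i} ∪ ⋃ t, ((M.1 t : Set G))) ∧
      (∀ j, j ≠ i → M'.2 j = M.2 j) ∧
      M'.2 i = g₁ * M.2 i * g₂)

/-- Equivalence of `G`-tuples: a finite chain of elementary moves. -/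
def gEquiv {n m : ℕ} :
    (Fin n → Subgroup G) × (Fin m → G) → (Fin n → Subgroup G) × (Fin m → G) → Prop :=
  Relation.ReflTransGen gMove

/-- The family of factors `U₁,…,U_n, F(h₁),…,F(h_m)`. -/
def FF {n : ℕ} (m : ℕ) (U : Fin n → Subgroup G) : Fin n ⊕ Fin m → Type _
  | Sum.inl j => ↥(U j)
  | Sum.inr _ => FreeGroup PUnit

instance ffGroup {n : ℕ} (m : ℕ) (U : Fin n → Subgroup G) :
    (i : Fin n ⊕ Fin m) → Group (FF m U i)
  | Sum.inl j => inferInstanceAs (Group ↥(U j))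
  | Sum.inr _ => inferInstanceAs (Group (FreeGroup PUnit))

def ffHoms {n m : ℕ} (U : Fin n → Subgroup G) (H : Fin m → G) :
    (i : Fin n ⊕ Fin m) → FF m U i →* G
  | Sum.inl j => (U j).subtype
  | Sum.inr j => FreeGroup.lift fun _ => H j

/-- The canonical homomorphism `U₁ ∗ ⋯ ∗ U_n ∗ F(H) → G`. -/
def freeProdHom {n m : ℕ} (U : Fin n → Subgroup G) (H : Fin m → G) :
    Monoid.CoprodI (FF m U) →* G :=
  Monoid.CoprodI.lift (ffHoms U H)

/-- `W = U₁ ∗ ⋯ ∗ U_n ∗ F(H)`: the canonical homomorphism is injective with image `W`. -/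
def IsFreeProdDecomp {n m : ℕ} (U : Fin n → Subgroup G) (H : Fin m → G)
    (W : Subgroup G) : Prop :=
  Function.Injective (freeProdHom U H) ∧ (freeProdHom U H).range = W

/-- Minimality of the `G`-pair `(V; H)` (relative to a `1`-hyperbolic `G`-space `X`). -/
def PairMinimal (X : Type*) [MetricSpace X] [MulAction G X] {m : ℕ}
    (V : Subgroup G) (H : Fin m → G) : Prop :=
  ∀ (V' : Subgroup G) (H' : Fin m → G),
    gEquiv ((fun _ : Fin 1 => V), H) ((fun _ : Fin 1 => V'), H') →
    (∑ i, lV X 1 V (H i)) ≤ (∑ i, lV X 1 V' (H' i)) + 1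

/-- An elementary Nielsen move on tuples of elements of `G`. -/
def NielsenMove {k : ℕ} (g g' : Fin k → G) : Prop :=
  (∃ i : Fin k, (∀ j, j ≠ i → g' j = g j) ∧ g' i = (g i)⁻¹) ∨
  (∃ i j : Fin k, i ≠ j ∧ (∀ t, t ≠ i → g' t = g t) ∧ g' i = g i * g j) ∨
  (∃ i j : Fin k, i ≠ j ∧ g' = g ∘ Equiv.swap i j)

/-- Nielsen equivalence: a finite chain of elementary Nielsen moves. -/
def NielsenEq {k : ℕ} : (Fin k → G) → (Fin k → G) → Prop :=
  Relation.ReflTransGen NielsenMove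

/-- Word length of `g` with respect to the (symmetrized) generating set `S`. -/
def wordLength (S : Set G) (g : G) : ℕ :=
  sInf {n : ℕ | ∃ f : Fin n → G, (∀ i, f i ∈ S ∨ (f i)⁻¹ ∈ S) ∧ (List.ofFn f).prod = g}

/-- `(X, ι)` is a model of the Cayley graph `Γ(G,S)`. -/
def IsCayleyGraph (G : Type*) [Group G] (S : Set G) (X : Type*) [MetricSpace X]
    [MulAction G X] (ι : G → X) : Prop :=
  IsometricAction G X ∧
  (∀ g h : G, ι (g * h) = g • ι h) ∧
  Function.Injective ι ∧
  GeodesicSpace X ∧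
  (∀ g h : G, dist (ι g) (ι h) = (wordLength S (g⁻¹ * h) : ℝ)) ∧
  ∀ x : X, ∃ g h : G, wordLength S (g⁻¹ * h) ≤ 1 ∧
    ∃ s : Set X, IsGeodesicSegment s (ι g) (ι h) ∧ x ∈ s

/-- `H` is a quasiconvex subgroup (with respect to the Cayley graph model `(X, ι)`). -/
def QCSubgroup (X : Type*) [MetricSpace X] (ι : G → X) (H : Subgroup G) : Prop :=
  ∃ ε : ℝ, 0 ≤ ε ∧ Quasiconvex ε (ι '' (H : Set G))

end GroupAction

/-- Every nontrivial element of finite order has finite centralizer. -/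
def AlmostTorsionFree (G : Type*) [Group G] : Prop :=
  ∀ g : G, g ≠ 1 → IsOfFinOrder g → ((Subgroup.centralizer {g} : Subgroup G) : Set G).Finite

/-- `U` is nontrivial and admits no nontrivial free product decomposition. -/
def FreelyIndecomposable (U : Type*) [Group U] : Prop :=
  Nontrivial U ∧
    ¬ ∃ A B : Subgroup U, A ≠ ⊥ ∧ B ≠ ⊥ ∧
        Function.Bijective (Monoid.Coprod.lift A.subtype B.subtype)

def InfiniteCyclic (U : Type*) [Group U] : Prop := Infinite U ∧ IsCyclic U

def VirtuallyCyclic (U : Type*) [Group U] : Prop :=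
  ∃ H : Subgroup U, H.index ≠ 0 ∧ IsCyclic ↥H

def NonElementary (U : Type*) [Group U] : Prop := ¬ Finite U ∧ ¬ VirtuallyCyclic U

end KW

universe u v

namespace KW

open Pointwise Metric Set

theorem seg_symm {X : Type v} [MetricSpace X] {s : Set X} {x y : X}
    (h : IsGeodesicSegment s x y) : IsGeodesicSegment s y x := by
  obtain ⟨b, f, hb, h0, h1, hd, rfl⟩ := h
  refine ⟨b, fun t => f (b - t), hb, by simpa using h1, by simpa using h0, ?_, ?_⟩
  · intro u hu v hv
    rw [hd (b - u) ⟨by linarith [hu.2], by linarith [hu.1]⟩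
      (b - v) ⟨by linarith [hv.2], by linarith [hv.1]⟩, abs_sub_comm]
    congr 1
    ring
  · ext q
    constructor
    · rintro ⟨t, ht, rfl⟩
      exact ⟨b - t, ⟨by linarith [ht.2], by linarith [ht.1]⟩, by simp⟩
    · rintro ⟨t, ht, rfl⟩
      exact ⟨b - t, ⟨by linarith [ht.2], by linarith [ht.1]⟩, rfl⟩

theorem seg_add {X : Type v} [MetricSpace X] {s : Set X} {x y q : X}
    (h : IsGeodesicSegment s x y) (hq : q ∈ s) : dist x q + dist q y = dist x y := by
  obtain ⟨b, f, hb, rfl, rfl, hd, rfl⟩ := h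
  obtain ⟨t, ht, rfl⟩ := hq
  rw [hd 0 ⟨le_refl _, hb⟩ t ht, hd t ht b ⟨hb, le_refl _⟩, hd 0 ⟨le_refl _, hb⟩ b ⟨hb, le_refl _⟩,
    abs_of_nonpos (by linarith [ht.1]), abs_of_nonpos (by linarith [ht.2]),
    abs_of_nonpos (by linarith)]
  ring

theorem seg_left {X : Type v} [MetricSpace X] {s : Set X} {x y : X}
    (h : IsGeodesicSegment s x y) : x ∈ s := by
  obtain ⟨b, f, hb, rfl, rfl, hd, rfl⟩ := h
  exact ⟨0, ⟨le_refl _, hb⟩, rfl⟩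

theorem seg_next {X : Type v} [MetricSpace X] {s : Set X} {x y q : X}
    (h : IsGeodesicSegment s x y) (hq : q ∈ s) {r : ℝ} (hr : 0 ≤ r) (hr' : r ≤ dist q y) :
    ∃ q' ∈ s, dist q q' = r ∧ dist x q' = dist x q + r ∧ dist q' y = dist q y - r := by
  have key := seg_add h hq
  have h' := h
  obtain ⟨b, f, hb, rfl, rfl, hd, rfl⟩ := h
  obtain ⟨t, ht, rfl⟩ := hq
  have e1 := hd t ht b ⟨hb, le_refl _⟩
  rw [abs_of_nonpos (by linarith [ht.2])] at e1
  have e0 := hd 0 ⟨le_refl _, hb⟩ t ht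
  rw [abs_of_nonpos (by linarith [ht.1])] at e0
  have hm : t + r ∈ Set.Icc 0 b := ⟨by linarith [ht.1], by linarith⟩
  refine ⟨f (t + r), ⟨t + r, hm, rfl⟩, ?_, ?_, ?_⟩
  · rw [hd t ht _ hm, abs_of_nonpos (by linarith)]
    ring
  · rw [hd 0 ⟨le_refl _, hb⟩ _ hm, e0, abs_of_nonpos (by linarith [hm.1])]
    ring
  · rw [hd _ hm b ⟨hb, le_refl _⟩, e1, abs_of_nonpos (by linarith [hm.2])]
    ring

theorem seg_gromov {X : Type v} [MetricSpace X] {s : Set X} {x y q : X}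
    (h : IsGeodesicSegment s x y) (hq : q ∈ s) (z : X) : gromov z x y ≤ dist z q := by
  have key := seg_add h hq
  have h1 := dist_triangle x q z
  have h2 := dist_triangle y q z
  rw [dist_comm y q, dist_comm q z] at h2
  rw [dist_comm q z] at h1
  unfold gromov
  linarith

theorem ray_seg {X : Type v} [MetricSpace X] {η : ℝ → X} (h : IsGeodesicRay η) {T : ℝ}
    (hT : 0 ≤ T) : IsGeodesicSegment (η '' Set.Icc 0 T) (η 0) (η T) :=
  ⟨T, η, hT, rfl, rfl, fun u hu v hv => h u v hu.1 hv.1, rfl⟩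

theorem bi_seg {X : Type v} [MetricSpace X] {η : ℝ → X} (h : IsBiGeodesic η) {a b : ℝ}
    (hT : a ≤ b) : IsGeodesicSegment (η '' Set.Icc a b) (η a) (η b) := by
  refine ⟨b - a, fun t => η (a + t), by linarith, by simp, by simp, ?_, ?_⟩
  · intro u hu v hv
    rw [h]
    congr 1
    ring
  · ext q
    constructor
    · rintro ⟨t, ht, rfl⟩
      exact ⟨t - a, ⟨by linarith [ht.1], by linarith [ht.2]⟩, by simp⟩
    · rintro ⟨t, ht, rfl⟩
      exact ⟨a + t, ⟨by linarith [ht.1], by linarith [ht.2]⟩, rfl⟩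

/-- Thin triangles, in a convenient form. -/
theorem thin {X : Type v} [MetricSpace X] {δ : ℝ} (hhyp : DeltaHyperbolic δ X) {x y z : X}
    {s₁ s₂ s₃ : Set X} (h₁ : IsGeodesicSegment s₁ x y) (h₂ : IsGeodesicSegment s₂ y z)
    (h₃ : IsGeodesicSegment s₃ x z) {p : X} (hp : p ∈ s₁) :
    (∃ q ∈ s₂, dist p q ≤ δ) ∨ (∃ q ∈ s₃, dist p q ≤ δ) := by
  obtain ⟨q, hq, hd⟩ := hhyp.2 x y z s₁ s₂ s₃ h₁ h₂ h₃ p hp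
  rcases hq with hq | hq
  · exact Or.inl ⟨q, hq, hd⟩
  · exact Or.inr ⟨q, hq, hd⟩

/-- Gromov products under moving of the basepoint and of the two points. -/
theorem gromov_move {X : Type v} [MetricSpace X] (x x' y y' z z' : X) :
    gromov x y z - dist x x' - dist y y' - dist z z' ≤ gromov x' y' z' := by
  unfold gromov
  have h1 := dist_triangle4 y y' x' x
  have h2 := dist_triangle4 z z' x' x
  have h3 := dist_triangle4 y' y z z'
  rw [dist_comm x' x] at h1 h2
  rw [dist_comm y' y] at h3
  linarith

/-- The coarse estimate for quadrilaterals. -/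
theorem quad_coarse {X : Type v} [MetricSpace X] {δ C : ℝ} (hδ : 0 < δ) (hC : 0 ≤ C)
    (hhyp : DeltaHyperbolic δ X) {A : Set X} (hqc : Quasiconvex C A) {z₁ z₂ a₁ a₂ x : X}
    (h₁ : a₁ ∈ A) (h₂ : a₂ ∈ A) (d₁ : dist z₁ a₁ ≤ 2 * δ + C) (d₂ : dist z₂ a₂ ≤ 2 * δ + C)
    {s : Set X} (hs : IsGeodesicSegment s z₁ z₂) (hx : x ∈ s) :
    ∃ a ∈ A, dist x a ≤ 4 * δ + C := by
  obtain ⟨s2, hs2⟩ := hhyp.1 z₂ a₂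
  obtain ⟨sd, hsd⟩ := hhyp.1 z₁ a₂
  obtain ⟨s1, hs1⟩ := hhyp.1 z₁ a₁
  obtain ⟨sA, hsA⟩ := hhyp.1 a₂ a₁
  rcases thin hhyp hs hs2 hsd hx with ⟨q, hq, hd⟩ | ⟨q, hq, hd⟩
  · refine ⟨a₂, h₂, ?_⟩
    have := seg_add hs2 hq
    have := dist_triangle x q a₂
    have := dist_nonneg (x := z₂) (y := q)
    linarith
  · rcases thin hhyp hsd hsA hs1 hq with ⟨w, hw, hdw⟩ | ⟨w, hw, hdw⟩
    · obtain ⟨a, ha, hda⟩ := hqc _ h₂ _ h₁ sA hsA w hw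
      refine ⟨a, ha, ?_⟩
      have := dist_triangle4 x q w a
      linarith
    · refine ⟨a₁, h₁, ?_⟩
      have := seg_add hs1 hw
      have := dist_triangle4 x q w a₁
      have := dist_nonneg (x := z₁) (y := w)
      linarith

/-- First part of the sharp estimate: `x` is not too far from `z₂`. -/
theorem sharp_aux1 {X : Type v} [MetricSpace X] {δ e : ℝ} (he : 0 < e) (heδ : δ = 20 * e)
    (hhyp : DeltaHyperbolic δ X) {A : Set X}
    (hconv : ∀ x ∈ A, ∀ y ∈ A, ∀ s : Set X, IsGeodesicSegment s x y → s ⊆ A)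
    {z₁ z₂ a₁ a₂ x : X}
    (h₁ : a₁ ∈ A) (h₂ : a₂ ∈ A) (d₁ : dist z₁ a₁ ≤ 2 * δ) (d₂ : dist z₂ a₂ ≤ 2 * δ)
    {s : Set X} (hs : IsGeodesicSegment s z₁ z₂) (hx : x ∈ s)
    (hfar : ∀ a ∈ A, 4 * δ - e ≤ dist x a) : dist x z₂ ≤ 2 * δ + e := by
  obtain ⟨s2, hs2⟩ := hhyp.1 z₂ a₂
  obtain ⟨sd, hsd⟩ := hhyp.1 z₂ a₁
  obtain ⟨s1, hs1⟩ := hhyp.1 z₁ a₁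
  obtain ⟨sA, hsA⟩ := hhyp.1 a₁ a₂
  rcases thin hhyp hs hsd hs1 hx with ⟨v, hv, hd⟩ | ⟨v, hv, hd⟩
  · rcases thin hhyp hsd hsA hs2 hv with ⟨w, hw, hdw⟩ | ⟨w, hw, hdw⟩
    · have := hfar w (hconv _ h₁ _ h₂ _ hsA hw)
      have := dist_triangle x v w
      linarith
    · have := seg_add hs2 hw
      have := hfar a₂ h₂
      have := dist_triangle4 x v w a₂
      have h5 := dist_triangle4 x v w z₂
      rw [dist_comm w z₂] at h5
      linarith
  · have := seg_add hs1 hv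
    have := hfar a₁ h₁
    have := dist_triangle x v a₁
    have := dist_nonneg (x := z₁) (y := v)
    linarith

/-- The sharp estimate for quadrilaterals with two vertices in a convex set. -/
theorem quad_sharp {X : Type v} [MetricSpace X] {δ e : ℝ} (he : 0 < e) (heδ : δ = 20 * e)
    (hhyp : DeltaHyperbolic δ X) {A : Set X}
    (hconv : ∀ x ∈ A, ∀ y ∈ A, ∀ s : Set X, IsGeodesicSegment s x y → s ⊆ A)
    {z₁ z₂ a₁ a₂ x : X}
    (h₁ : a₁ ∈ A) (h₂ : a₂ ∈ A) (d₁ : dist z₁ a₁ ≤ 2 * δ) (d₂ : dist z₂ a₂ ≤ 2 * δ)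
    {s : Set X} (hs : IsGeodesicSegment s z₁ z₂) (hx : x ∈ s) :
    ∃ a ∈ A, dist x a ≤ 4 * δ - e := by
  by_contra hcon
  have hfar : ∀ a ∈ A, 4 * δ - e ≤ dist x a := by
    intro a ha
    by_contra hlt
    exact hcon ⟨a, ha, by linarith⟩
  have u2 : dist x z₂ ≤ 2 * δ + e := sharp_aux1 he heδ hhyp hconv h₁ h₂ d₁ d₂ hs hx hfar
  have u1 : dist x z₁ ≤ 2 * δ + e :=
    sharp_aux1 he heδ hhyp hconv h₂ h₁ d₂ d₁ (seg_symm hs) hx hfar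
  have l1 : 2 * δ - e ≤ dist x z₁ := by
    have := hfar a₁ h₁
    have := dist_triangle x z₁ a₁
    linarith
  have l2 : 2 * δ - e ≤ dist x z₂ := by
    have := hfar a₂ h₂
    have := dist_triangle x z₂ a₂
    linarith
  -- every point of `A` is far from `z₁` or from `z₂`
  have htype : ∀ a ∈ A, 4 * δ - 2 * e ≤ dist z₁ a + 0 ∨ 4 * δ - 2 * e ≤ dist z₂ a := by
    intro a ha
    obtain ⟨t1, ht1⟩ := hhyp.1 z₁ a
    obtain ⟨t2, ht2⟩ := hhyp.1 z₂ a
    rcases thin hhyp hs ht2 ht1 hx with ⟨v, hv, hd⟩ | ⟨v, hv, hd⟩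
    · right
      have := seg_add ht2 hv
      have := hfar a ha
      have := dist_triangle x v a
      have h4 := dist_triangle x v z₂
      rw [dist_comm v z₂] at h4
      linarith
    · left
      have := seg_add ht1 hv
      have := hfar a ha
      have := dist_triangle x v a
      have h4 := dist_triangle x v z₁
      rw [dist_comm v z₁] at h4
      linarith
  obtain ⟨sA, hsA⟩ := hhyp.1 a₁ a₂
  obtain ⟨s1, hs1⟩ := hhyp.1 z₁ a₁
  obtain ⟨s2, hs2⟩ := hhyp.1 z₂ a₂
  obtain ⟨sd, hsd⟩ := hhyp.1 z₁ a₂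
  obtain ⟨r1, hr1⟩ := hhyp.1 x a₁
  obtain ⟨r2, hr2⟩ := hhyp.1 x a₂
  obtain ⟨c1, hc1⟩ := hhyp.1 x z₁
  -- the points `a₁`, `a₂` are far apart
  have hD : 4 * δ - 4 * e ≤ dist a₁ a₂ := by
    obtain ⟨m, hm, hm1, -, hm3⟩ := seg_next hsA (seg_left hsA) (r := dist a₁ a₂ / 2)
      (by have := dist_nonneg (x := a₁) (y := a₂); linarith)
      (by have := dist_nonneg (x := a₁) (y := a₂); linarith)
    rcases htype m (hconv _ h₁ _ h₂ _ hsA hm) with h | h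
    · have := dist_triangle z₁ a₁ m
      linarith
    · have := dist_triangle z₂ a₂ m
      rw [dist_comm a₂ m] at this
      linarith
  -- lower bound on `dist z₁ a₂`
  have hL : 6 * δ - 10 * e ≤ dist z₁ a₂ := by
    obtain ⟨x', hx', e1, e2, e3⟩ := seg_next hs hx (r := δ - 2 * e) (by linarith) (by linarith)
    have hfar' : ∀ a ∈ A, 3 * δ + e ≤ dist x' a := by
      intro a ha
      have := hfar a ha
      have := dist_triangle x x' a
      linarith
    rcases thin hhyp hs hs2 hsd hx' with ⟨v, hv, hd⟩ | ⟨v, hv, hd⟩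
    · have := seg_add hs2 hv
      have := hfar' a₂ h₂
      have := dist_triangle x' v a₂
      have := dist_nonneg (x := z₂) (y := v)
      linarith
    · have hfarv : ∀ a ∈ A, 2 * δ + e ≤ dist v a := by
        intro a ha
        have := hfar' a ha
        have := dist_triangle x' v a
        linarith
      have hrv : 2 * δ - 3 * e ≤ dist z₁ v := by
        have h4 := dist_triangle z₁ v x'
        rw [dist_comm v x'] at h4
        rw [dist_comm z₁ x] at e2
        linarith
      obtain ⟨g, hg, g1, g2, g3⟩ := seg_next hsd hv (r := δ) (by linarith)
        (by have := hfarv a₂ h₂; linarith)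
      rcases thin hhyp hsd (seg_symm hsA) hs1 hg with ⟨q, hq, hdq⟩ | ⟨q, hq, hdq⟩
      · have := hfarv q (hconv _ h₁ _ h₂ _ hsA hq)
        have := dist_triangle v g q
        linarith
      · have := seg_add hs1 hq
        have h4 := dist_triangle z₁ q g
        rw [dist_comm q g] at h4
        have h5 := dist_triangle4 a₁ q g a₂
        rw [dist_comm a₁ q, dist_comm q g] at h5
        have := seg_add hsd hg
        linarith
  -- upper bound on `dist z₁ a₂`
  have hU : dist z₁ a₂ ≤ 5 * δ + 3 * e := by
    have f2 := hfar a₂ h₂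
    have f2' := dist_triangle x z₂ a₂
    obtain ⟨p, hp, p1, -, p3⟩ := seg_next hr2 (seg_left hr2) (r := 3 * δ - 2 * e) (by linarith)
      (by linarith)
    rcases thin hhyp hr2 (seg_symm hsA) hr1 hp with ⟨y, hy, hdy⟩ | ⟨y, hy, hdy⟩
    · have := hfar y (hconv _ h₁ _ h₂ _ hsA hy)
      have := dist_triangle x p y
      linarith
    · have t1 := dist_triangle4 z₁ y p a₂
      rw [dist_comm y p] at t1
      suffices dist z₁ y ≤ 3 * δ by linarith
      rcases thin hhyp hr1 (seg_symm hs1) hc1 hy with ⟨q, hq, hdq⟩ | ⟨q, hq, hdq⟩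
      · have := seg_add hs1 hq
        have t2 := dist_triangle z₁ q y
        rw [dist_comm q y] at t2
        have := dist_nonneg (x := q) (y := a₁)
        linarith
      · have := seg_add hc1 hq
        have t2 := dist_triangle z₁ q y
        rw [dist_comm q y, dist_comm z₁ q] at t2
        have t3 := dist_triangle4 x q y p
        rw [dist_comm q y, dist_comm y p] at t3
        linarith
  linarith

/-- Points of `A` close (seen from `z`) to the far end of a ray representing a limit point. -/
theorem limit_approx {G : Type u} {X : Type v} [Group G] [MetricSpace X] [MulAction G X]
    (hiso : IsometricAction G X) (U : Subgroup G) {A : Set X} (hne : A.Nonempty)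
    (hinv : ∀ u : G, u ∈ U → u • A = A) {p : Boundary X} (hp : p ∈ limitSet X U)
    {η : ℝ → X} (hη : RayTo η p) (z : X) (M : ℝ) :
    ∃ N : ℝ, ∀ T : ℝ, N ≤ T → ∃ b ∈ A, M ≤ gromov z b (η T) := by
  obtain ⟨a, ha⟩ := hne
  obtain ⟨x₀, u, γ, hγ, hconv⟩ := hp
  obtain ⟨hray, hmk⟩ := hη
  have hasym : Asymptotic η γ.1 := by
    have : Boundary.mk ⟨η, hray⟩ = Boundary.mk γ := hmk.trans hγ.symm
    exact Quotient.exact this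
  obtain ⟨K, hK, -⟩ := hasym
  obtain ⟨N, hN⟩ := hconv (M + dist x₀ z + dist x₀ a + (K + 1))
  refine ⟨max 0 (N + 1 + K + dist (η 0) (γ.1 0)), fun T hT => ?_⟩
  have hT0 : 0 ≤ T := (le_max_left _ _).trans hT
  have hT1 := (le_max_right _ _).trans hT
  obtain ⟨_, ⟨t, ht, rfl⟩, hd⟩ := hK (η T) ⟨T, hT0, rfl⟩
  have ht0 : (0 : ℝ) ≤ t := ht
  have e1 := hray 0 T le_rfl hT0
  rw [abs_of_nonpos (by linarith)] at e1
  have e2 := γ.2 0 t le_rfl ht0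
  rw [abs_of_nonpos (by linarith)] at e2
  have e3 := dist_triangle4 (η 0) (γ.1 0) (γ.1 t) (η T)
  rw [dist_comm (γ.1 t) (η T)] at e3
  have hfl := Nat.floor_le ht0
  have hfl' := Nat.lt_floor_add_one t
  have hm : N ≤ ⌊t⌋₊ := Nat.le_floor (by linarith)
  have e4 := γ.2 t (⌊t⌋₊ : ℝ) ht0 (by positivity)
  rw [abs_of_nonneg (by linarith)] at e4
  refine ⟨(u N : G) • a, ?_, ?_⟩
  · rw [← hinv (u N : G) (u N).2]
    exact Set.smul_mem_smul_set ha
  · have h1 := hN N le_rfl _ hm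
    have h2 := gromov_move x₀ z ((u N : G) • x₀) ((u N : G) • a) (γ.1 (⌊t⌋₊ : ℝ)) (η T)
    rw [hiso] at h2
    have h3 := dist_triangle (η T) (γ.1 t) (γ.1 (⌊t⌋₊ : ℝ))
    rw [dist_comm (γ.1 (⌊t⌋₊ : ℝ)) (η T)] at h2
    simp only at h1
    linarith

theorem limit_far {G : Type u} {X : Type v} [Group G] [MetricSpace X] [MulAction G X] {δ : ℝ}
    (hhyp : DeltaHyperbolic δ X)
    (hiso : IsometricAction G X) (U : Subgroup G) {A : Set X} (hne : A.Nonempty)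
    (hinv : ∀ u : G, u ∈ U → u • A = A) {p : Boundary X} (hp : p ∈ limitSet X U)
    {x : X} {u : ℕ → X} (hu : SeqConvTo x u p) (z : X) (M : ℝ) (N₀ : ℕ) :
    ∃ n, N₀ ≤ n ∧ ∃ b ∈ A, ∀ s : Set X, IsGeodesicSegment s (u n) b → ∀ q ∈ s, M ≤ dist z q := by
  obtain ⟨γ, hγ, hconv⟩ := hu
  obtain ⟨N₁, hN₁⟩ := hconv (M + δ + dist x z)
  obtain ⟨N₂, hN₂⟩ := limit_approx hiso U hne hinv hp (η := γ.1) ⟨γ.2, hγ⟩ z (M + δ)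
  obtain ⟨m, hm⟩ := exists_nat_ge N₂
  obtain ⟨b, hb, hbg⟩ := hN₂ ((max m N₁ : ℕ) : ℝ)
    (hm.trans (by exact_mod_cast le_max_left _ _))
  have h1 := hN₁ (max N₀ N₁) (le_max_right _ _) (max m N₁) (le_max_right _ _)
  refine ⟨max N₀ N₁, le_max_left _ _, b, hb, fun s hs q hq => ?_⟩
  have h2 := gromov_move x z (u (max N₀ N₁)) (u (max N₀ N₁)) (γ.1 ((max m N₁ : ℕ) : ℝ))
    (γ.1 ((max m N₁ : ℕ) : ℝ))
  rw [dist_self, dist_self] at h2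
  obtain ⟨t1, ht1⟩ := hhyp.1 b (γ.1 ((max m N₁ : ℕ) : ℝ))
  obtain ⟨t2, ht2⟩ := hhyp.1 (u (max N₀ N₁)) (γ.1 ((max m N₁ : ℕ) : ℝ))
  rcases thin hhyp hs ht1 ht2 hq with ⟨w, hw, hd⟩ | ⟨w, hw, hd⟩
  · have h3 := seg_gromov ht1 hw z
    have h4 := dist_triangle z q w
    linarith
  · have h3 := seg_gromov ht2 hw z
    have h4 := dist_triangle z q w
    linarith

theorem ray_near {G : Type u} {X : Type v} [Group G] [MetricSpace X] [MulAction G X] {δ C : ℝ}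
    (hδ : 0 < δ) (hhyp : DeltaHyperbolic δ X)
    (hiso : IsometricAction G X) (U : Subgroup G) {A : Set X} (hne : A.Nonempty)
    (hqc : Quasiconvex C A)
    (hinv : ∀ u : G, u ∈ U → u • A = A) {p : Boundary X} (hp : p ∈ limitSet X U)
    {η : ℝ → X} (hη : RayTo η p) (h0 : η 0 ∈ A) {t : ℝ} (ht : 0 ≤ t) :
    ∃ a ∈ A, dist (η t) a ≤ 2 * δ + C := by
  obtain ⟨N, hN⟩ := limit_approx hiso U hne hinv hp hη (η t) (2 * δ)
  obtain ⟨b, hb, hg⟩ := hN (max N t) (le_max_left _ _)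
  have hT : t ≤ max N t := le_max_right _ _
  obtain ⟨hray, -⟩ := hη
  have hs := ray_seg hray (ht.trans hT)
  obtain ⟨s2, hs2⟩ := hhyp.1 b (η (max N t))
  obtain ⟨s3, hs3⟩ := hhyp.1 (η 0) b
  rcases thin hhyp hs (seg_symm hs2) hs3 ⟨t, ⟨ht, hT⟩, rfl⟩ with ⟨w, hw, hd⟩ | ⟨w, hw, hd⟩
  · have := seg_gromov hs2 hw (η t)
    linarith
  · obtain ⟨a, ha, hda⟩ := hqc _ h0 _ hb s3 hs3 w hw
    exact ⟨a, ha, by have := dist_triangle (η t) w a; linarith⟩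

theorem bi_near {G : Type u} {X : Type v} [Group G] [MetricSpace X] [MulAction G X] {δ C : ℝ}
    (hδ : 0 < δ) (hhyp : DeltaHyperbolic δ X)
    (hiso : IsometricAction G X) (U : Subgroup G) {A : Set X} (hne : A.Nonempty)
    (hqc : Quasiconvex C A)
    (hinv : ∀ u : G, u ∈ U → u • A = A) {p q : Boundary X} (hp : p ∈ limitSet X U)
    (hq : q ∈ limitSet X U) {η : ℝ → X} (hη : BiGeodesicJoins η p q) (t : ℝ) :
    ∃ a ∈ A, dist (η t) a ≤ 2 * δ + C := by
  obtain ⟨hbi, hcp, hcq⟩ := hη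
  obtain ⟨k, hk⟩ := exists_nat_ge |t|
  obtain ⟨n, hn, b, hb, hbf⟩ := limit_far hhyp hiso U hne hinv hp hcp (η t) (3 * δ) k
  obtain ⟨n', hn', b', hb', hbf'⟩ := limit_far hhyp hiso U hne hinv hq hcq (η t) (3 * δ) k
  have hn1 : (k : ℝ) ≤ n := by exact_mod_cast hn
  have hn2 : (k : ℝ) ≤ n' := by exact_mod_cast hn'
  have habs := abs_le.1 hk
  have hs := bi_seg hbi (a := -(n : ℝ)) (b := n') (by linarith [habs.1, habs.2])
  obtain ⟨s1, hs1⟩ := hhyp.1 (η (-(n : ℝ))) b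
  obtain ⟨s2, hs2⟩ := hhyp.1 (η (n' : ℝ)) b'
  obtain ⟨sd, hsd⟩ := hhyp.1 (η (n' : ℝ)) b
  obtain ⟨sA, hsA⟩ := hhyp.1 b b'
  rcases thin hhyp hs hsd hs1 (p := η t) ⟨t, ⟨by linarith [habs.1], by linarith [habs.2]⟩, rfl⟩
    with ⟨v, hv, hd⟩ | ⟨v, hv, hd⟩
  · rcases thin hhyp hsd hsA hs2 hv with ⟨w, hw, hdw⟩ | ⟨w, hw, hdw⟩
    · obtain ⟨a, ha, hda⟩ := hqc _ hb _ hb' sA hsA w hw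
      exact ⟨a, ha, by have := dist_triangle4 (η t) v w a; linarith⟩
    · have := hbf' s2 hs2 w hw
      have := dist_triangle (η t) v w
      linarith
  · have := hbf s1 hs1 v hv
    linarith

theorem Z_near {G : Type u} {X : Type v} [Group G] [MetricSpace X] [MulAction G X] {δ C : ℝ}
    (hδ : 0 < δ) (hC : 0 ≤ C) (hhyp : DeltaHyperbolic δ X)
    (hiso : IsometricAction G X) (U : Subgroup G) {A : Set X} (hne : A.Nonempty)
    (hqc : Quasiconvex C A)
    (hinv : ∀ u : G, u ∈ U → u • A = A) (hE : smallDispSet X δ U ⊆ A) {z : X}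
    (hz : z ∈ ZSet X δ U) : ∃ a ∈ A, dist z a ≤ 2 * δ + C := by
  rcases hz with ⟨a, hA, rfl⟩ | ⟨p, hp, q, hq, -, s, hs, hzs⟩
  · have : (Sum.inl z : X ⊕ Boundary X) ∈
        (Sum.inr '' limitSet X U ∪ Sum.inl '' smallDispSet X δ U : Set (X ⊕ Boundary X)) := by
      rw [hA]
      rfl
    rcases this with ⟨_, _, h⟩ | ⟨z', hz', h⟩
    · cases h
    · cases h
      exact ⟨z, hE hz', by rw [dist_self]; linarith⟩
  · rcases hp with ⟨p, hp, rfl⟩ | ⟨p, hp, rfl⟩ <;> rcases hq with ⟨q, hq, rfl⟩ | ⟨q, hq, rfl⟩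
    · obtain ⟨η, hη, rfl⟩ := hs
      obtain ⟨t, rfl⟩ := hzs
      exact bi_near hδ hhyp hiso U hne hqc hinv hp hq hη t
    · obtain ⟨η, h0, hη, rfl⟩ := hs
      obtain ⟨t, ht, rfl⟩ := hzs
      exact ray_near hδ hhyp hiso U hne hqc hinv hp hη (h0 ▸ hE hq) ht
    · obtain ⟨η, h0, hη, rfl⟩ := hs
      obtain ⟨t, ht, rfl⟩ := hzs
      exact ray_near hδ hhyp hiso U hne hqc hinv hq hη (h0 ▸ hE hp) ht
    · obtain ⟨a, ha, hd⟩ := hqc _ (hE hp) _ (hE hq) s hs z hzs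
      exact ⟨a, ha, by linarith⟩

theorem conv_near {X : Type v} [MetricSpace X] {Z : Set X} {P : X → Prop}
    (h1 : ∀ z ∈ Z, P z)
    (h2 : ∀ z ∈ Z, ∀ z' ∈ Z, ∀ s, IsGeodesicSegment s z z' → ∀ x ∈ s, P x)
    {x : X} (hx : x ∈ geoConv (Sum.inl '' Z : Set (X ⊕ Boundary X))) : P x := by
  rcases hx with ⟨a, hA, rfl⟩ | ⟨p, hp, q, hq, -, s, hs, hxs⟩
  · have : (Sum.inl x : X ⊕ Boundary X) ∈ (Sum.inl '' Z : Set (X ⊕ Boundary X)) := by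
      rw [hA]
      rfl
    obtain ⟨z, hz, h⟩ := this
    cases h
    exact h1 _ hz
  · obtain ⟨z, hz, rfl⟩ := hp
    obtain ⟨z', hz', rfl⟩ := hq
    exact h2 z hz z' hz' s hs x hxs

theorem statement10 {G : Type u} {X : Type v} [Group G] [MetricSpace X] [MulAction G X]
    (δ : ℝ) (hδ : 0 < δ) (hiso : IsometricAction G X) (hsg : StronglyGeodesic X)
    (hhyp : DeltaHyperbolic δ X) (U : Subgroup G) (hU : U ≠ ⊥)
    (C : ℝ) (A : Set X) (hne : A.Nonempty) (hqc : Quasiconvex C A)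
    (hinv : ∀ u : G, u ∈ U → u • A = A)
    (hsub : ∀ a ∈ A, ∃ z ∈ cHull X δ U, dist a z ≤ C)
    (hE : smallDispSet X δ U ⊆ A) :
    HClose (3 * C + 4 * δ) (cHull X δ U) A := by
  have hC : 0 ≤ C := by
    obtain ⟨a, ha⟩ := hne
    obtain ⟨z, -, hz⟩ := hsub a ha
    exact dist_nonneg.trans hz
  refine ⟨?_, ?_⟩
  · intro x hx
    -- a bound with some room to spare
    obtain ⟨e, he, hnear⟩ : ∃ e : ℝ, 0 < e ∧
        ∀ y ∈ geoConv (Sum.inl '' ZSet X δ U : Set (X ⊕ Boundary X)),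
          ∃ a ∈ A, dist y a ≤ 3 * C + 4 * δ - e := by
      rcases hC.eq_or_lt with h0 | hpos
      · subst h0
        refine ⟨δ / 20, by linarith, fun y hy => ?_⟩
        have hconv : ∀ x ∈ A, ∀ y ∈ A, ∀ s : Set X, IsGeodesicSegment s x y → s ⊆ A := by
          intro x hx y hy s hs p hp
          obtain ⟨a, ha, hd⟩ := hqc x hx y hy s hs p hp
          rwa [dist_le_zero.1 hd]
        refine conv_near (P := fun y => ∃ a ∈ A, dist y a ≤ 3 * 0 + 4 * δ - δ / 20) ?_ ?_ hy
        · intro z hz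
          obtain ⟨a, ha, hd⟩ := Z_near hδ le_rfl hhyp hiso U hne hqc hinv hE hz
          exact ⟨a, ha, by linarith⟩
        · intro z hz z' hz' s hs x hx
          obtain ⟨a, ha, hd⟩ := Z_near hδ le_rfl hhyp hiso U hne hqc hinv hE hz
          obtain ⟨a', ha', hd'⟩ := Z_near hδ le_rfl hhyp hiso U hne hqc hinv hE hz'
          obtain ⟨c, hc, hdc⟩ := quad_sharp (e := δ / 20) (by linarith) (by ring) hhyp hconv
            ha ha' (by linarith) (by linarith) hs hx
          exact ⟨c, hc, by linarith⟩
      · refine ⟨C, hpos, fun y hy => ?_⟩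
        refine conv_near (P := fun y => ∃ a ∈ A, dist y a ≤ 3 * C + 4 * δ - C) ?_ ?_ hy
        · intro z hz
          obtain ⟨a, ha, hd⟩ := Z_near hδ hC hhyp hiso U hne hqc hinv hE hz
          exact ⟨a, ha, by linarith⟩
        · intro z hz z' hz' s hs x hx
          obtain ⟨a, ha, hd⟩ := Z_near hδ hC hhyp hiso U hne hqc hinv hE hz
          obtain ⟨a', ha', hd'⟩ := Z_near hδ hC hhyp hiso U hne hqc hinv hE hz'
          obtain ⟨c, hc, hdc⟩ := quad_coarse hδ hC hhyp hqc ha ha' hd hd' hs hx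
          exact ⟨c, hc, by linarith⟩
    obtain ⟨y, hy, hd⟩ := Metric.mem_closure_iff.1 hx e he
    obtain ⟨a, ha, hda⟩ := hnear y hy
    exact ⟨a, ha, by have := dist_triangle x y a; linarith⟩
  · intro a ha
    obtain ⟨z, hz, hd⟩ := hsub a ha
    exact ⟨z, hz, by rw [dist_comm]; linarith⟩

end KW
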